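/- Let (A, [·,·], ∧) be a Gerstenhaber algebra, E the graded vector space with E_{−k} := A^k, l_1 := 0, l_2(P_1,P_2) := (−1)^{|P_1|}[P_1,P_2], and l_i := ι_{l_2}𝒩_{i−1} for i > 2, where 𝒩_k(P_1,…,P_k) := P_1∧⋯∧P_k. Then the family (l_n)_{n≥1} is a pencil of L∞-algebras on E (all l_n are pairwise compatible L∞-structures), and therefore μ = Σ_{i≥1} a_i l_i is an L∞-structure on E for all real coefficients a_i. -/

import Mathlib

open Finset

section Framework

variable {V : Type*} [AddCommGroup V] [Module ℝ V]

/-- The Koszul sign `ε(σ)` of a permutation `σ` acting on homogeneous elements whose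
degrees are given by `d`. -/
def koszulSign {n : ℕ} (d : Fin n → ℤ) (σ : Equiv.Perm (Fin n)) : ℤ :=
  ∏ p ∈ Finset.univ.filter (fun p : Fin n × Fin n => p.1 < p.2 ∧ σ p.2 < σ p.1),
    (-1 : ℤ) ^ (d (σ p.1) * d (σ p.2)).natAbs

/-- The `(k, n-k)`-unshuffles: permutations of `Fin n` which are increasing on the
first `k` indices and on the remaining ones. -/
def unshuffles (k n : ℕ) : Finset (Equiv.Perm (Fin n)) :=
  Finset.univ.filter (fun σ =>
    (∀ i j : Fin n, i < j → (j : ℕ) < k → σ i < σ j) ∧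
    (∀ i j : Fin n, i < j → k ≤ (i : ℕ) → σ i < σ j))

/-- A (raw) vector valued `k`-form on the graded vector space with grading `𝒢`:
it assigns, to homogeneous elements of degrees `d 0, …, d (k-1)`, an element of `V`. -/
abbrev GForm (𝒢 : ℤ → Submodule ℝ V) (k : ℕ) : Type _ :=
  (d : Fin k → ℤ) → ((i : Fin k) → 𝒢 (d i)) → V

/-- Transport of a vector valued form along an equality of arities. -/
def castForm {𝒢 : ℤ → Submodule ℝ V} {m n : ℕ} (h : m = n) (K : GForm 𝒢 m) : GForm 𝒢 n :=
  h ▸ K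

variable (𝒢 : ℤ → Submodule ℝ V)

/-- Projection on the homogeneous component of degree `i`. -/
def prj [DirectSum.Decomposition 𝒢] (i : ℤ) (v : V) : 𝒢 i :=
  DirectSum.decompose 𝒢 v i

/-- Insertion of a `k`-form `K` of degree `δK` into an `(l+1)`-form `L`:
`ι_K L (X_1,…,X_{k+l}) = Σ_{σ ∈ Sh(k,l)} ε(σ) L(K(X_{σ(1)},…,X_{σ(k)}), X_{σ(k+1)},…)`. -/
def insertPos [DirectSum.Decomposition 𝒢] {k l : ℕ} (δK : ℤ) (K : GForm 𝒢 k)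
    (L : GForm 𝒢 (l + 1)) : GForm 𝒢 (k + l) := fun d x =>
  ∑ σ ∈ unshuffles k (k + l),
    koszulSign d σ •
      L (Fin.cons ((∑ i : Fin k, d (σ (Fin.castAdd l i))) + δK)
          (fun j : Fin l => d (σ (Fin.natAdd k j))))
        (Fin.cons
          (prj 𝒢 ((∑ i : Fin k, d (σ (Fin.castAdd l i))) + δK)
            (K (fun i => d (σ (Fin.castAdd l i))) (fun i => x (σ (Fin.castAdd l i)))))
          (fun j : Fin l => x (σ (Fin.natAdd k j))))

/-- Insertion operator `ι_K L` of a `k`-form of degree `δK` into an `l`-form. -/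
def insertionOp [DirectSum.Decomposition 𝒢] {k l : ℕ} (δK : ℤ) (K : GForm 𝒢 k) :
    GForm 𝒢 l → GForm 𝒢 (k + l - 1) :=
  match l with
  | 0 => fun _ => fun _ _ => 0
  | _ + 1 => fun L => insertPos 𝒢 δK K L

/-- A formal sum of vector valued forms of all arities. -/
abbrev MultiForm : Type _ := (k : ℕ) → GForm 𝒢 k

/-- A single `k`-form seen as a formal sum concentrated in arity `k`. -/
def singleF (k : ℕ) (K : GForm 𝒢 k) : MultiForm 𝒢 :=
  fun n => if h : n = k then castForm h.symm K else 0

/-- The Richardson–Nijenhuis bracket `[K,L] = ι_K L - (-1)^{K̄ L̄} ι_L K` of formal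
sums of forms `K` (of degree `δK`) and `L` (of degree `δL`), computed aritywise. -/
def rnBracketM [DirectSum.Decomposition 𝒢] (δK δL : ℤ) (K L : MultiForm 𝒢) : MultiForm 𝒢 :=
  fun n =>
    (∑ p ∈ (Finset.range (n + 2)).attach,
      castForm (by have := Finset.mem_range.mp p.2; omega)
        (insertionOp 𝒢 δK (K p.1) (L (n + 1 - p.1))))
    - ((-1 : ℤ) ^ (δK * δL).natAbs) •
      (∑ p ∈ (Finset.range (n + 2)).attach,
        castForm (by have := Finset.mem_range.mp p.2; omega)
          (insertionOp 𝒢 δL (L p.1) (K (n + 1 - p.1))))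

/-- `K` is a graded symmetric vector valued `k`-form of degree `δ`. -/
structure IsSymFormOfDeg {k : ℕ} (δ : ℤ) (K : GForm 𝒢 k) : Prop where
  mem_grading : ∀ (d : Fin k → ℤ) (x : (i : Fin k) → 𝒢 (d i)), K d x ∈ 𝒢 ((∑ i, d i) + δ)
  map_add : ∀ (d : Fin k → ℤ) (x : (i : Fin k) → 𝒢 (d i)) (i : Fin k) (a b : 𝒢 (d i)),
    K d (Function.update x i (a + b)) = K d (Function.update x i a) + K d (Function.update x i b)
  map_smul : ∀ (d : Fin k → ℤ) (x : (i : Fin k) → 𝒢 (d i)) (i : Fin k) (c : ℝ) (a : 𝒢 (d i)),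
    K d (Function.update x i (c • a)) = c • K d (Function.update x i a)
  symm : ∀ (d : Fin k → ℤ) (σ : Equiv.Perm (Fin k)) (x : (i : Fin k) → 𝒢 (d i)),
    K (d ∘ σ) (fun i => x (σ i)) = koszulSign d σ • K d x

/-- The `L_∞` identities for a family `(l_i)` of symmetric vector valued forms of degree 1:
for each `n`, `Σ_{i+j=n+1} Σ_{σ ∈ Sh(i,j-1)} ε(σ) l_j (l_i (X_σ(1),…), X_…) = 0`. -/
def LInftyIdentity [DirectSum.Decomposition 𝒢] (l : MultiForm 𝒢) : Prop :=
  ∀ n : ℕ,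
    (∑ p ∈ (Finset.range (n + 2)).attach,
      castForm (by have := Finset.mem_range.mp p.2; omega)
        (insertionOp 𝒢 1 (l p.1) (l (n + 1 - p.1)))) = (0 : GForm 𝒢 n)

end Framework

section Gerstenhaber

variable {V : Type*} [AddCommGroup V] [Module ℝ V]

/-- A Gerstenhaber algebra structure on a graded vector space `(V, 𝒜)`: a graded
commutative associative product `wedge` together with a graded Lie bracket on the
shifted space which is a degree `i` derivation in each argument. -/
structure Gerstenhaber (𝒜 : ℤ → Submodule ℝ V) : Type _ where
  wedge : V →ₗ[ℝ] V →ₗ[ℝ] V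
  bracket : V →ₗ[ℝ] V →ₗ[ℝ] V
  wedge_mem : ∀ (i j : ℤ) (x y : V), x ∈ 𝒜 i → y ∈ 𝒜 j → wedge x y ∈ 𝒜 (i + j)
  bracket_mem : ∀ (i j : ℤ) (x y : V), x ∈ 𝒜 i → y ∈ 𝒜 j → bracket x y ∈ 𝒜 (i + j - 1)
  wedge_assoc : ∀ x y z, wedge (wedge x y) z = wedge x (wedge y z)
  wedge_comm : ∀ (i j : ℤ) (x y : V), x ∈ 𝒜 i → y ∈ 𝒜 j →
    wedge x y = ((-1 : ℤ) ^ (i * j).natAbs) • wedge y x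
  bracket_antisymm : ∀ (i j : ℤ) (x y : V), x ∈ 𝒜 i → y ∈ 𝒜 j →
    bracket x y = -(((-1 : ℤ) ^ ((i - 1) * (j - 1)).natAbs) • bracket y x)
  jacobi : ∀ (i j : ℤ) (x y z : V), x ∈ 𝒜 i → y ∈ 𝒜 j →
    bracket x (bracket y z) = bracket (bracket x y) z
      + ((-1 : ℤ) ^ ((i - 1) * (j - 1)).natAbs) • bracket y (bracket x z)
  leibniz : ∀ (i j : ℤ) (x y z : V), x ∈ 𝒜 i → y ∈ 𝒜 j →
    bracket x (wedge y z) = wedge (bracket x y) z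
      + ((-1 : ℤ) ^ ((i - 1) * j).natAbs) • wedge y (bracket x z)

variable {𝒜 : ℤ → Submodule ℝ V}

/-- The grading of the graded vector space `E` with `E_{-k} := A^k`. -/
abbrev negG (𝒜 : ℤ → Submodule ℝ V) : ℤ → Submodule ℝ V := fun i => 𝒜 (-i)

/-- Iterated wedge product of `k+1` elements. -/
def wedgeAll (G : Gerstenhaber 𝒜) : {k : ℕ} → (Fin (k + 1) → V) → V
  | 0, x => x 0
  | _ + 1, x => G.wedge (x 0) (wedgeAll G (fun i => x i.succ))

/-- The symmetric vector valued `k`-form `𝒩_k (P_1, …, P_k) := P_1 ∧ ⋯ ∧ P_k`. -/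
def mathcalN (G : Gerstenhaber 𝒜) (𝒢 : ℤ → Submodule ℝ V) : (k : ℕ) → GForm 𝒢 k
  | 0 => fun _ _ => 0
  | _ + 1 => fun _ x => wedgeAll G (fun i => (x i : V))

/-- The symmetric vector valued 2-form `l_2 (P_1, P_2) := (-1)^{|P_1|} [P_1, P_2]`. -/
def l2G (G : Gerstenhaber 𝒜) (𝒢 : ℤ → Submodule ℝ V) : GForm 𝒢 2 :=
  fun d x => ((-1 : ℤ) ^ (d 0).natAbs) • G.bracket (x 0) (x 1)

/-- The family `l_1 := 0`, `l_2`, and `l_i := ι_{l_2} 𝒩_{i-1}` for `i > 2`. -/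
def lFormsG (G : Gerstenhaber 𝒜) (𝒢 : ℤ → Submodule ℝ V) [DirectSum.Decomposition 𝒢] :
    (i : ℕ) → GForm 𝒢 i
  | 0 => 0
  | 1 => 0
  | 2 => l2G G 𝒢
  | i + 3 => castForm (by omega) (insertionOp 𝒢 1 (l2G G 𝒢) (mathcalN G 𝒢 (i + 2)))

end Gerstenhaber

section Unshuffles

/-- The sign `(-1)^n` of an integer exponent. -/
def sgn (n : ℤ) : ℤ := (-1) ^ n.natAbs

lemma sgn_eq_ite (n : ℤ) : sgn n = if Even n then 1 else -1 := by
  unfold sgn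
  split_ifs with h
  · exact (Int.natAbs_even.2 h).neg_one_pow
  · exact (Int.natAbs_odd.2 (Int.not_even_iff_odd.1 h)).neg_one_pow

lemma sgn_add (a b : ℤ) : sgn (a + b) = sgn a * sgn b := by
  simp only [sgn_eq_ite, Int.even_add]
  by_cases ha : Even a <;> by_cases hb : Even b <;> simp [ha, hb]

/-- The permutation of `Fin (n + 1)` sending `p` to `0` and acting as `σ` elsewhere. -/
def insertZero {n : ℕ} (p : Fin (n + 1)) (σ : Equiv.Perm (Fin n)) : Equiv.Perm (Fin (n + 1)) :=
  ((finSuccEquiv' p).trans (Equiv.optionCongr σ)).trans (finSuccEquiv' 0).symm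

@[simp] lemma insertZero_self {n : ℕ} (p : Fin (n + 1)) (σ : Equiv.Perm (Fin n)) :
    insertZero p σ p = 0 := by
  simp [insertZero]

@[simp] lemma insertZero_succAbove {n : ℕ} (p : Fin (n + 1)) (σ : Equiv.Perm (Fin n))
    (i : Fin n) : insertZero p σ (p.succAbove i) = (σ i).succ := by
  simp [insertZero]

@[simp] lemma insertZero_zero_succ {n : ℕ} (σ : Equiv.Perm (Fin n)) (i : Fin n) :
    insertZero 0 σ i.succ = (σ i).succ := by
  simpa using insertZero_succAbove 0 σ i

lemma insertZero_injective {n : ℕ} (p : Fin (n + 1)) :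
    Function.Injective (insertZero p) := by
  intro σ τ h
  ext i
  have := congrArg (fun f : Equiv.Perm (Fin (n + 1)) => f (p.succAbove i)) h
  simpa using congrArg Fin.val this

lemma exists_insertZero {n : ℕ} (p : Fin (n + 1)) (τ : Equiv.Perm (Fin (n + 1)))
    (h : τ p = 0) : ∃ σ, insertZero p σ = τ := by
  have hne (i : Fin n) : τ (p.succAbove i) ≠ 0 := by
    rw [← h]
    exact fun e => Fin.succAbove_ne p i (τ.injective e)
  have hinj : Function.Injective fun i => (τ (p.succAbove i)).pred (hne i) := by
    intro i j hij
    exact Fin.succAbove_right_injective (τ.injective (Fin.pred_inj.1 hij))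
  refine ⟨Equiv.ofBijective _ (Finite.injective_iff_bijective.1 hinj), ?_⟩
  ext j
  rcases Fin.eq_self_or_eq_succAbove p j with rfl | ⟨i, rfl⟩
  · simp [h]
  · simp

lemma insertZero_zero_mem_unshuffles {n k : ℕ} (σ : Equiv.Perm (Fin n)) :
    insertZero 0 σ ∈ unshuffles (k + 1) (n + 1) ↔ σ ∈ unshuffles k n := by
  simp only [unshuffles, Finset.mem_filter, Finset.mem_univ, true_and]
  constructor
  · rintro ⟨h₁, h₂⟩
    refine ⟨fun i j hij hj => ?_, fun i j hij hi => ?_⟩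
    · simpa using h₁ i.succ j.succ (by simpa) (by simpa)
    · simpa using h₂ i.succ j.succ (by simpa) (by simpa)
  · rintro ⟨h₁, h₂⟩
    refine ⟨fun i j => ?_, fun i j => ?_⟩
    · refine Fin.cases ?_ (fun i => ?_) i <;> refine Fin.cases ?_ (fun j => ?_) j
      · simp
      · simp
      · simp
      · simpa using h₁ i j
    · refine Fin.cases ?_ (fun i => ?_) i <;> refine Fin.cases ?_ (fun j => ?_) j
      · simp
      · simp
      · simp
      · simpa using h₂ i j

lemma insertZero_mem_unshuffles {n k : ℕ} (hk : k < n + 1) (σ : Equiv.Perm (Fin n)) :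
    insertZero ⟨k, hk⟩ σ ∈ unshuffles k (n + 1) ↔ σ ∈ unshuffles k n := by
  simp only [unshuffles, Finset.mem_filter, Finset.mem_univ, true_and]
  have val (i : Fin n) : ((Fin.succAbove ⟨k, hk⟩ i : Fin (n + 1)) : ℕ)
      = if (i : ℕ) < k then (i : ℕ) else i + 1 := by
    simp only [Fin.succAbove, Fin.lt_def, Fin.val_castSucc]
    split_ifs <;> simp
  constructor
  · rintro ⟨h₁, h₂⟩
    refine ⟨fun i j hij hj => ?_, fun i j hij hi => ?_⟩
    · simpa using h₁ (Fin.succAbove ⟨k, hk⟩ i) (Fin.succAbove ⟨k, hk⟩ j) (by simpa)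
        (by rw [val, if_pos hj]; exact hj)
    · simpa using h₂ (Fin.succAbove ⟨k, hk⟩ i) (Fin.succAbove ⟨k, hk⟩ j) (by simpa)
        (by rw [val, if_neg (by omega)]; omega)
  · rintro ⟨h₁, h₂⟩
    refine ⟨fun i j hij hj => ?_, fun i j hij hi => ?_⟩ <;>
    rcases Fin.eq_self_or_eq_succAbove ⟨k, hk⟩ i with rfl | ⟨i, rfl⟩ <;>
    rcases Fin.eq_self_or_eq_succAbove ⟨k, hk⟩ j with rfl | ⟨j, rfl⟩
    · simp at hij
    · have := Fin.lt_def.1 hij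
      simp only at this
      omega
    · simp at hj
    · simp only [insertZero_succAbove, Fin.succ_lt_succ_iff]
      refine h₁ i j (by simpa using hij) ?_
      rw [val] at hj
      split_ifs at hj <;> omega
    · simp at hij
    · simp
    · have := Fin.lt_def.1 hij
      simp only at this
      omega
    · simp only [insertZero_succAbove, Fin.succ_lt_succ_iff]
      refine h₂ i j (by simpa using hij) ?_
      rw [val] at hi
      split_ifs at hi <;> omega

lemma symm_zero_of_mem_unshuffles {n k : ℕ} {σ : Equiv.Perm (Fin (n + 1))}
    (hσ : σ ∈ unshuffles k (n + 1)) : σ.symm 0 = 0 ∨ (σ.symm 0 : ℕ) = k := by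
  simp only [unshuffles, Finset.mem_filter, Finset.mem_univ, true_and] at hσ
  obtain ⟨h₁, h₂⟩ := hσ
  by_contra! h
  obtain ⟨h0, hk⟩ := h
  rcases lt_or_gt_of_ne hk with hlt | hgt
  · simpa using h₁ 0 (σ.symm 0) (Fin.pos_of_ne_zero h0) hlt
  · have := (σ.symm 0).isLt
    simpa using h₂ ⟨k, by omega⟩ (σ.symm 0) (Fin.lt_def.2 hgt) le_rfl

lemma sum_unshuffles_filter {M : Type*} [AddCommMonoid M] {n k k' : ℕ} (p : Fin (n + 1))
    (hp : ∀ σ, insertZero p σ ∈ unshuffles k (n + 1) ↔ σ ∈ unshuffles k' n)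
    (Φ : Equiv.Perm (Fin (n + 1)) → M) :
    ∑ σ ∈ (unshuffles k (n + 1)).filter (fun σ => σ.symm 0 = p), Φ σ
      = ∑ σ ∈ unshuffles k' n, Φ (insertZero p σ) := by
  symm
  refine Finset.sum_bij (fun σ _ => insertZero p σ) ?_ ?_ ?_ ?_
  · intro σ hσ
    rw [Finset.mem_filter, hp, Equiv.symm_apply_eq]
    exact ⟨hσ, by simp⟩
  · intro σ _ τ _ h
    exact insertZero_injective p h
  · intro τ hτ
    rw [Finset.mem_filter, Equiv.symm_apply_eq] at hτ
    obtain ⟨σ, rfl⟩ := exists_insertZero p τ hτ.2.symm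
    exact ⟨σ, (hp σ).1 hτ.1, rfl⟩
  · intros
    rfl

lemma sum_unshuffles_zero {M : Type*} [AddCommMonoid M] {n : ℕ}
    (Φ : Equiv.Perm (Fin (n + 1)) → M) :
    ∑ σ ∈ unshuffles 0 (n + 1), Φ σ = ∑ σ ∈ unshuffles 0 n, Φ (insertZero 0 σ) := by
  rw [← sum_unshuffles_filter (k := 0) 0
    (fun σ => insertZero_mem_unshuffles (k := 0) (by omega) σ) Φ]
  rw [Finset.filter_true_of_mem]
  intro σ hσ
  rcases symm_zero_of_mem_unshuffles hσ with h | h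
  · exact h
  · exact Fin.ext h

lemma sum_unshuffles_top {M : Type*} [AddCommMonoid M] {n : ℕ}
    (Φ : Equiv.Perm (Fin (n + 1)) → M) :
    ∑ σ ∈ unshuffles (n + 1) (n + 1), Φ σ = ∑ σ ∈ unshuffles n n, Φ (insertZero 0 σ) := by
  rw [← sum_unshuffles_filter 0 insertZero_zero_mem_unshuffles Φ]
  rw [Finset.filter_true_of_mem]
  intro σ hσ
  rcases symm_zero_of_mem_unshuffles hσ with h | h
  · exact h
  · have := (σ.symm 0).isLt
    omega

lemma sum_unshuffles_succ {M : Type*} [AddCommMonoid M] {n k : ℕ} (hk : k + 1 < n + 1)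
    (Φ : Equiv.Perm (Fin (n + 1)) → M) :
    ∑ σ ∈ unshuffles (k + 1) (n + 1), Φ σ = ∑ σ ∈ unshuffles k n, Φ (insertZero 0 σ)
      + ∑ σ ∈ unshuffles (k + 1) n, Φ (insertZero ⟨k + 1, hk⟩ σ) := by
  rw [← sum_unshuffles_filter 0 insertZero_zero_mem_unshuffles Φ,
    ← sum_unshuffles_filter ⟨k + 1, hk⟩ (insertZero_mem_unshuffles hk) Φ,
    ← Finset.sum_filter_add_sum_filter_not (unshuffles (k + 1) (n + 1))
      (fun σ => σ.symm 0 = 0)]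
  congr 1
  refine Finset.sum_congr (Finset.filter_congr fun σ hσ => ?_) fun _ _ => rfl
  constructor
  · intro h
    exact Fin.ext ((symm_zero_of_mem_unshuffles hσ).resolve_left h)
  · intro h
    rw [h]
    simp [Fin.ext_iff]

lemma koszulSign_eq_prod {n : ℕ} (d : Fin n → ℤ) (σ : Equiv.Perm (Fin n)) :
    koszulSign d σ = ∏ i, ∏ j, if i < j ∧ σ j < σ i then sgn (d (σ i) * d (σ j)) else 1 := by
  rw [koszulSign, Finset.prod_filter, Fintype.prod_prod_type]
  rfl

lemma koszulSign_insertZero {n : ℕ} (d : Fin (n + 1) → ℤ) (p : Fin (n + 1))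
    (σ : Equiv.Perm (Fin n)) :
    koszulSign d (insertZero p σ)
      = (∏ i : Fin n, if i.castSucc < p then sgn (d 0 * d (σ i).succ) else 1)
        * koszulSign (fun i => d i.succ) σ := by
  simp only [koszulSign_eq_prod]
  rw [Fin.prod_univ_succAbove _ p, Fin.prod_univ_succAbove _ p]
  simp only [Fin.prod_univ_succAbove _ p, insertZero_self, insertZero_succAbove,
    Fin.not_lt_zero, and_false, if_false, Finset.prod_const_one, mul_one, one_mul,
    Fin.succAbove_lt_iff_castSucc_lt, Fin.succ_pos, and_true,
    (Fin.strictMono_succAbove p).lt_iff_lt, Fin.succ_lt_succ_iff, Finset.prod_mul_distrib]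
  simp only [mul_comm (d 0)]

end Unshuffles

section CutSum

variable {V : Type*} [AddCommGroup V] [Module ℝ V] {𝒢 : ℤ → Submodule ℝ V}

/-- The total degree of a word of homogeneous elements. -/
def wordDeg (w : List (Σ i, 𝒢 i)) : ℤ := (w.map Sigma.fst).sum

@[simp] lemma wordDeg_nil : wordDeg ([] : List (Σ i, 𝒢 i)) = 0 := rfl

@[simp] lemma wordDeg_cons (a : Σ i, 𝒢 i) (w : List (Σ i, 𝒢 i)) :
    wordDeg (a :: w) = a.1 + wordDeg w := by
  simp [wordDeg]

/-- The sum of `Ψ u v`, with Koszul signs, over all ways of splitting the word `w` into two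
complementary subwords `u` and `v`. -/
def cutSum {M : Type*} [AddCommGroup M] : List (Σ i, 𝒢 i) →
    (List (Σ i, 𝒢 i) → List (Σ i, 𝒢 i) → M) → M
  | [], Ψ => Ψ [] []
  | a :: w, Ψ => cutSum w (fun u v => Ψ (a :: u) v)
      + cutSum w (fun u v => sgn (a.1 * wordDeg u) • Ψ u (a :: v))

variable {M : Type*} [AddCommGroup M]

lemma cutSum_congr' (w : List (Σ i, 𝒢 i)) (Ψ Φ : List (Σ i, 𝒢 i) → List (Σ i, 𝒢 i) → M)
    (h : ∀ u v, wordDeg w = wordDeg u + wordDeg v → w.length = u.length + v.length →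
      Ψ u v = Φ u v) : cutSum w Ψ = cutSum w Φ := by
  induction w generalizing Ψ Φ with
  | nil => exact h [] [] (by simp) (by simp)
  | cons a w ih =>
    simp only [cutSum]
    congr 1
    · refine ih _ _ fun u v hd hl => h _ _ ?_ ?_
      · simp [hd, add_assoc]
      · simp only [List.length_cons, hl]
        omega
    · refine ih _ _ fun u v hd hl => ?_
      rw [h]
      · simp only [wordDeg_cons, hd]
        ring
      · simp only [List.length_cons, hl]
        omega

lemma cutSum_congr {w : List (Σ i, 𝒢 i)} {Ψ Φ : List (Σ i, 𝒢 i) → List (Σ i, 𝒢 i) → M}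
    (h : ∀ u v, Ψ u v = Φ u v) : cutSum w Ψ = cutSum w Φ :=
  cutSum_congr' w Ψ Φ fun u v _ _ => h u v

lemma map_cutSum {M' : Type*} [AddCommGroup M'] (f : M →+ M') (w : List (Σ i, 𝒢 i))
    (Ψ : List (Σ i, 𝒢 i) → List (Σ i, 𝒢 i) → M) :
    f (cutSum w Ψ) = cutSum w fun u v => f (Ψ u v) := by
  induction w generalizing Ψ with
  | nil => rfl
  | cons a w ih => simp only [cutSum, map_add, ih, map_zsmul]

lemma cutSum_add (w : List (Σ i, 𝒢 i)) (Ψ Φ : List (Σ i, 𝒢 i) → List (Σ i, 𝒢 i) → M) :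
    cutSum w (fun u v => Ψ u v + Φ u v) = cutSum w Ψ + cutSum w Φ := by
  induction w generalizing Ψ Φ with
  | nil => rfl
  | cons a w ih =>
    simp only [cutSum, smul_add, ih]
    abel

lemma cutSum_zero (w : List (Σ i, 𝒢 i)) : cutSum w (fun _ _ => (0 : M)) = 0 := by
  induction w with
  | nil => rfl
  | cons a w ih => simp [cutSum, ih]

lemma zsmul_cutSum (n : ℤ) (w : List (Σ i, 𝒢 i))
    (Ψ : List (Σ i, 𝒢 i) → List (Σ i, 𝒢 i) → M) :
    n • cutSum w Ψ = cutSum w fun u v => n • Ψ u v :=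
  map_cutSum (zsmulAddGroupHom n) w Ψ

lemma smul_cutSum [Module ℝ M] (c : ℝ) (w : List (Σ i, 𝒢 i))
    (Ψ : List (Σ i, 𝒢 i) → List (Σ i, 𝒢 i) → M) :
    c • cutSum w Ψ = cutSum w fun u v => c • Ψ u v :=
  map_cutSum (LinearMap.lsmul ℝ M c).toAddMonoidHom w Ψ

lemma cutSum_comm (w : List (Σ i, 𝒢 i)) (Ψ : List (Σ i, 𝒢 i) → List (Σ i, 𝒢 i) → M) :
    cutSum w Ψ = cutSum w fun u v => sgn (wordDeg u * wordDeg v) • Ψ v u := by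
  induction w generalizing Ψ with
  | nil => simp [cutSum, sgn]
  | cons a w ih =>
    simp only [cutSum]
    rw [add_comm, ih]
    nth_rw 2 [ih]
    congr 1 <;> refine cutSum_congr fun u v => ?_
    · rw [smul_smul, ← sgn_add, wordDeg_cons]
      ring_nf
    · rw [smul_smul, wordDeg_cons, ← sgn_add]
      congr 1
      simp only [sgn_eq_ite]
      congr 1
      simp only [Int.even_add, Int.even_mul, eq_iff_iff]
      tauto

lemma cutSum_assoc (w : List (Σ i, 𝒢 i))
    (Ψ : List (Σ i, 𝒢 i) → List (Σ i, 𝒢 i) → List (Σ i, 𝒢 i) → M) :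
    cutSum w (fun p r => cutSum p fun u v => Ψ u v r)
      = cutSum w fun u q => cutSum q fun v r => Ψ u v r := by
  induction w generalizing Ψ with
  | nil => rfl
  | cons a w ih =>
    simp only [cutSum, cutSum_add, smul_add, zsmul_cutSum]
    rw [ih fun u v r => Ψ (a :: u) v r, ih fun u v r => sgn (a.1 * wordDeg u) • Ψ u (a :: v) r,
      add_assoc]
    congr 2
    rw [← ih fun u v r => sgn (a.1 * wordDeg u) • sgn (a.1 * wordDeg v) • Ψ u v (a :: r)]
    refine cutSum_congr fun p r => cutSum_congr' _ _ _ fun u v hd _ => ?_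
    rw [hd, mul_add, sgn_add, mul_smul]

lemma wordDeg_ofFn {n : ℕ} (x : Fin n → Σ i, 𝒢 i) : wordDeg (List.ofFn x) = ∑ i, (x i).1 := by
  simp [wordDeg, List.map_ofFn, List.sum_ofFn]

lemma prod_sgn_eq_take {n : ℕ} (e : ℤ) (k : ℕ) (x : Fin n → Σ i, 𝒢 i) :
    (∏ i : Fin n, if (i : ℕ) < k then sgn (e * (x i).1) else 1)
      = sgn (e * wordDeg ((List.ofFn x).take k)) := by
  induction n generalizing k with
  | zero => simp [sgn]
  | succ n ih =>
    cases k with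
    | zero => simp [sgn]
    | succ k =>
      rw [Fin.prod_univ_succ, List.ofFn_succ, List.take_succ_cons, wordDeg_cons, mul_add, sgn_add,
        ← ih k]
      simp

lemma take_ofFn_succAbove {α : Type*} {n : ℕ} (x : Fin (n + 1) → α) (p : Fin (n + 1)) :
    (List.ofFn x).take p = (List.ofFn fun i => x (p.succAbove i)).take p := by
  induction n with
  | zero => simp [Fin.fin_one_eq_zero p]
  | succ n ih =>
    refine Fin.cases (by simp) (fun p => ?_) p
    rw [List.ofFn_succ, List.ofFn_succ (n := n)]
    simpa using ih (fun i => x i.succ) p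

lemma drop_ofFn_succAbove {α : Type*} {n : ℕ} (x : Fin (n + 1) → α) (p : Fin (n + 1)) :
    (List.ofFn x).drop p = x p :: (List.ofFn fun i => x (p.succAbove i)).drop p := by
  induction n with
  | zero => simp [Fin.fin_one_eq_zero p]
  | succ n ih =>
    refine Fin.cases (by simp) (fun p => ?_) p
    rw [List.ofFn_succ, List.ofFn_succ (n := n)]
    simpa using ih (fun i => x i.succ) p

/-- Sums over unshuffles are sums over complementary subwords of prescribed lengths. -/
lemma sum_unshuffles_eq_cutSum {n k : ℕ} (hk : k ≤ n) (x : Fin n → Σ i, 𝒢 i)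
    (Ψ : List (Σ i, 𝒢 i) → List (Σ i, 𝒢 i) → M) :
    ∑ σ ∈ unshuffles k n, koszulSign (fun i => (x i).1) σ •
        Ψ ((List.ofFn fun i => x (σ i)).take k) ((List.ofFn fun i => x (σ i)).drop k)
      = cutSum (List.ofFn x) fun u v => if u.length = k then Ψ u v else 0 := by
  induction n generalizing k Ψ with
  | zero =>
    obtain rfl : k = 0 := by omega
    have : unshuffles 0 0 = {1} := by decide
    simp [this, cutSum, koszulSign]
  | succ n ih =>
    have first (k : ℕ) (hk : k ≤ n) :
        ∑ σ ∈ unshuffles k n, koszulSign (fun i => (x i).1) (insertZero 0 σ) •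
          Ψ ((List.ofFn fun i => x (insertZero 0 σ i)).take (k + 1))
            ((List.ofFn fun i => x (insertZero 0 σ i)).drop (k + 1))
          = cutSum (List.ofFn fun i => x i.succ) fun u v =>
              if (x 0 :: u).length = k + 1 then Ψ (x 0 :: u) v else 0 := by
      simp only [List.length_cons, Nat.add_right_cancel_iff]
      rw [← ih hk (fun i => x i.succ) fun u v => Ψ (x 0 :: u) v]
      refine Finset.sum_congr rfl fun σ _ => ?_
      rw [koszulSign_insertZero, List.ofFn_succ]
      simp
    have second (k : ℕ) (hk : k < n + 1) :
        ∑ σ ∈ unshuffles k n, koszulSign (fun i => (x i).1) (insertZero ⟨k, hk⟩ σ) •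
          Ψ ((List.ofFn fun i => x (insertZero ⟨k, hk⟩ σ i)).take k)
            ((List.ofFn fun i => x (insertZero ⟨k, hk⟩ σ i)).drop k)
          = cutSum (List.ofFn fun i => x i.succ) fun u v => sgn ((x 0).1 * wordDeg u) •
              if u.length = k then Ψ u (x 0 :: v) else 0 := by
      simp only [smul_ite, smul_zero]
      rw [← ih (by omega) (fun i => x i.succ) fun u v =>
        sgn ((x 0).1 * wordDeg u) • Ψ u (x 0 :: v)]
      refine Finset.sum_congr rfl fun σ _ => ?_
      have ht := take_ofFn_succAbove (fun i => x (insertZero ⟨k, hk⟩ σ i)) ⟨k, hk⟩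
      have hd := drop_ofFn_succAbove (fun i => x (insertZero ⟨k, hk⟩ σ i)) ⟨k, hk⟩
      simp only [insertZero_succAbove, insertZero_self] at ht hd
      rw [ht, hd, koszulSign_insertZero, smul_smul, mul_comm]
      simp only [Fin.lt_def, Fin.val_castSucc]
      rw [prod_sgn_eq_take (x 0).1 k fun i => x (σ i).succ]
    rw [List.ofFn_succ, cutSum]
    rcases Nat.eq_zero_or_pos k with rfl | hpos
    · rw [sum_unshuffles_zero]
      refine (second 0 (by omega)).trans ?_
      simp [cutSum_zero]
    · obtain ⟨k, rfl⟩ := Nat.exists_eq_succ_of_ne_zero hpos.ne'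
      rcases hk.lt_or_eq with hlt | heq
      · rw [Nat.succ_eq_add_one] at *
        rw [sum_unshuffles_succ hlt, first k (by omega), second (k + 1) hlt]
      · obtain rfl : k = n := by omega
        rw [Nat.succ_eq_add_one, sum_unshuffles_top, first k le_rfl]
        symm
        rw [add_eq_left]
        refine (cutSum_congr' _ _ _ fun u v _ hl => ?_).trans (cutSum_zero _)
        rw [if_neg, smul_zero]
        rw [List.length_ofFn] at hl
        omega

end CutSum

section WordForms

variable {V : Type*} [AddCommGroup V] [Module ℝ V] {𝒜 : ℤ → Submodule ℝ V}

lemma cutSum_eq_nil_left {M : Type*} [AddCommGroup M] {𝒢 : ℤ → Submodule ℝ V}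
    (w : List (Σ i, 𝒢 i)) (Ψ : List (Σ i, 𝒢 i) → List (Σ i, 𝒢 i) → M)
    (h : ∀ a u v, Ψ (a :: u) v = 0) : cutSum w Ψ = Ψ [] w := by
  induction w generalizing Ψ with
  | nil => rfl
  | cons a w ih =>
    simp only [cutSum, h, cutSum_zero, zero_add]
    rw [ih _ fun b u v => by rw [h, smul_zero]]
    simp [sgn]

lemma cutSum_eq_nil_right {M : Type*} [AddCommGroup M] {𝒢 : ℤ → Submodule ℝ V}
    (w : List (Σ i, 𝒢 i)) (Ψ : List (Σ i, 𝒢 i) → List (Σ i, 𝒢 i) → M)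
    (h : ∀ u a v, Ψ u (a :: v) = 0) : cutSum w Ψ = Ψ w [] := by
  rw [cutSum_comm, cutSum_eq_nil_left _ _ fun a u v => by rw [h, smul_zero]]
  simp [sgn]

namespace Gerstenhaber

variable (G : Gerstenhaber 𝒜)

lemma wedge_comm_neg {i j : ℤ} {x y : V} (hx : x ∈ 𝒜 (-i)) (hy : y ∈ 𝒜 (-j)) :
    G.wedge x y = sgn (i * j) • G.wedge y x := by
  rw [G.wedge_comm _ _ _ _ hx hy, neg_mul_neg]
  rfl

lemma wedge_mem_neg {i j : ℤ} {x y : V} (hx : x ∈ 𝒜 (-i)) (hy : y ∈ 𝒜 (-j)) :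
    G.wedge x y ∈ 𝒜 (-(i + j)) := by
  rw [neg_add]
  exact G.wedge_mem _ _ _ _ hx hy

lemma bracket_mem_neg {i j : ℤ} {x y : V} (hx : x ∈ 𝒜 (-i)) (hy : y ∈ 𝒜 (-j)) :
    G.bracket x y ∈ 𝒜 (-(i + j + 1)) := by
  have := G.bracket_mem _ _ _ _ hx hy
  rwa [show -i + -j - 1 = -(i + j + 1) by omega] at this

lemma bracket_antisymm_neg {i j : ℤ} {x y : V} (hx : x ∈ 𝒜 (-i)) (hy : y ∈ 𝒜 (-j)) :
    G.bracket x y = -(sgn ((i + 1) * (j + 1)) • G.bracket y x) := by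
  rw [G.bracket_antisymm _ _ _ _ hx hy, show (-i - 1) * (-j - 1) = (i + 1) * (j + 1) by ring]
  rfl

lemma jacobi_neg {i j : ℤ} {x y : V} (hx : x ∈ 𝒜 (-i)) (hy : y ∈ 𝒜 (-j)) (z : V) :
    G.bracket x (G.bracket y z) = G.bracket (G.bracket x y) z
      + sgn ((i + 1) * (j + 1)) • G.bracket y (G.bracket x z) := by
  rw [G.jacobi _ _ _ _ _ hx hy, show (-i - 1) * (-j - 1) = (i + 1) * (j + 1) by ring]
  rfl

lemma leibniz_neg {i j : ℤ} {x y : V} (hx : x ∈ 𝒜 (-i)) (hy : y ∈ 𝒜 (-j)) (z : V) :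
    G.bracket x (G.wedge y z) = G.wedge (G.bracket x y) z
      + sgn ((i + 1) * j) • G.wedge y (G.bracket x z) := by
  rw [G.leibniz _ _ _ _ _ hx hy, show (-i - 1) * (-j) = (i + 1) * j by ring]
  rfl

lemma bracket_wedge_neg {i j k : ℤ} {x y z : V} (hx : x ∈ 𝒜 (-i)) (hy : y ∈ 𝒜 (-j))
    (hz : z ∈ 𝒜 (-k)) : G.bracket (G.wedge x y) z = G.wedge x (G.bracket y z)
      + sgn (j * (k + 1)) • G.wedge (G.bracket x z) y := by
  rw [G.bracket_antisymm_neg (G.wedge_mem_neg hx hy) hz, G.leibniz_neg hz hx,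
    G.bracket_antisymm_neg hz hx, G.bracket_antisymm_neg hz hy]
  simp only [map_neg, map_zsmul, LinearMap.neg_apply, LinearMap.smul_apply, smul_add, smul_neg,
    smul_smul, sgn_eq_ite, Int.even_add, Int.even_mul, Int.not_even_one]
  by_cases hi : Even i <;> by_cases hj : Even j <;> by_cases hk : Even k <;>
    simp [hi, hj, hk, add_comm]

/-- The word function underlying `l₂`. -/
def pairBracket : List (Σ i, negG 𝒜 i) → V
  | [a, b] => sgn a.1 • G.bracket a.2 b.2
  | _ => 0

/-- The word function of `l₂` with an element of degree `e` inserted in first position. -/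
def headBracket (e : ℤ) : List (Σ i, negG 𝒜 i) → V →ₗ[ℝ] V
  | [b] => sgn e • G.bracket.flip b.2
  | _ => 0

/-- Multiplication on the right by the letters of a word. -/
def wedgeWord : List (Σ i, negG 𝒜 i) → V →ₗ[ℝ] V
  | [] => LinearMap.id
  | a :: w => wedgeWord w ∘ₗ G.wedge.flip a.2

/-- The word function whose restriction to words of length `n` is `lₙ`. -/
def bracketWord (w : List (Σ i, negG 𝒜 i)) : V :=
  cutSum w fun u v => G.wedgeWord v (G.pairBracket u)

/-- The word function `bracketWord` with an element `y` of degree `e` inserted in first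
position. -/
def headBracketWord (e : ℤ) (w : List (Σ i, negG 𝒜 i)) (y : V) : V :=
  cutSum w (fun u v => G.wedgeWord v (G.headBracket e u y))
    + cutSum w fun u v => sgn (e * wordDeg u) • G.wedgeWord v (G.wedge (G.pairBracket u) y)

@[simp] lemma wedgeWord_nil (y : V) : G.wedgeWord [] y = y := rfl

@[simp] lemma wedgeWord_cons (a : Σ i, negG 𝒜 i) (w : List (Σ i, negG 𝒜 i)) (y : V) :
    G.wedgeWord (a :: w) y = G.wedgeWord w (G.wedge y a.2) := rfl

@[simp] lemma pairBracket_nil : G.pairBracket [] = 0 := rfl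

@[simp] lemma pairBracket_singleton (a : Σ i, negG 𝒜 i) : G.pairBracket [a] = 0 := rfl

@[simp] lemma pairBracket_pair (a b : Σ i, negG 𝒜 i) :
    G.pairBracket [a, b] = sgn a.1 • G.bracket a.2 b.2 := rfl

@[simp] lemma pairBracket_cons_cons_cons (a b c : Σ i, negG 𝒜 i) (w : List (Σ i, negG 𝒜 i)) :
    G.pairBracket (a :: b :: c :: w) = 0 := rfl

@[simp] lemma headBracket_nil (e : ℤ) (y : V) : G.headBracket e [] y = 0 := rfl

@[simp] lemma headBracket_singleton (e : ℤ) (b : Σ i, negG 𝒜 i) (y : V) :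
    G.headBracket e [b] y = sgn e • G.bracket y b.2 := rfl

@[simp] lemma headBracket_cons_cons (e : ℤ) (b c : Σ i, negG 𝒜 i) (w : List (Σ i, negG 𝒜 i))
    (y : V) : G.headBracket e (b :: c :: w) y = 0 := rfl

lemma pairBracket_cons (a : Σ i, negG 𝒜 i) (w : List (Σ i, negG 𝒜 i)) :
    G.pairBracket (a :: w) = G.headBracket a.1 w a.2 := by
  rcases w with _ | ⟨b, _ | ⟨c, w⟩⟩ <;> rfl

lemma bracketWord_cons (a : Σ i, negG 𝒜 i) (w : List (Σ i, negG 𝒜 i)) :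
    G.bracketWord (a :: w) = G.headBracketWord a.1 w a.2 := by
  simp only [bracketWord, cutSum, pairBracket_cons, wedgeWord_cons, headBracketWord]

lemma pairBracket_eq_zero {w : List (Σ i, negG 𝒜 i)} (h : w.length ≠ 2) :
    G.pairBracket w = 0 := by
  rcases w with _ | ⟨a, _ | ⟨b, _ | ⟨c, w⟩⟩⟩ <;> simp at h ⊢

lemma headBracket_eq_zero (e : ℤ) {w : List (Σ i, negG 𝒜 i)} (h : w.length ≠ 1) (y : V) :
    G.headBracket e w y = 0 := by
  rcases w with _ | ⟨a, _ | ⟨b, w⟩⟩ <;> simp at h ⊢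

lemma pairBracket_mem (w : List (Σ i, negG 𝒜 i)) : G.pairBracket w ∈ 𝒜 (-(wordDeg w + 1)) := by
  rcases w with _ | ⟨a, _ | ⟨b, _ | ⟨c, w⟩⟩⟩
  · simp
  · simp
  · simpa using zsmul_mem (G.bracket_mem_neg a.2.2 b.2.2) _
  · simp

lemma pairBracket_swap (a b : Σ i, negG 𝒜 i) :
    G.pairBracket [a, b] = sgn (a.1 * b.1) • G.pairBracket [b, a] := by
  rw [pairBracket_pair, pairBracket_pair, G.bracket_antisymm_neg a.2.2 b.2.2, smul_neg, smul_smul,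
    smul_smul, ← neg_smul]
  congr 1
  simp only [sgn_eq_ite, Int.even_add, Int.even_mul, Int.not_even_one]
  by_cases ha : Even a.1 <;> by_cases hb : Even b.1 <;> simp [ha, hb]

lemma wedgeWord_mem {e : ℤ} {y : V} (hy : y ∈ 𝒜 (-e)) (w : List (Σ i, negG 𝒜 i)) :
    G.wedgeWord w y ∈ 𝒜 (-(e + wordDeg w)) := by
  induction w generalizing e y with
  | nil => simpa using hy
  | cons a w ih => simpa [add_assoc] using ih (G.wedge_mem_neg hy a.2.2)

lemma wedge_wedgeWord (y z : V) (w : List (Σ i, negG 𝒜 i)) :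
    G.wedge y (G.wedgeWord w z) = G.wedgeWord w (G.wedge y z) := by
  induction w generalizing z with
  | nil => rfl
  | cons a w ih => rw [wedgeWord_cons, wedgeWord_cons, ih, G.wedge_assoc]

lemma wedgeWord_wedge {e : ℤ} {z : V} (hz : z ∈ 𝒜 (-e)) (y : V) (w : List (Σ i, negG 𝒜 i)) :
    G.wedge (G.wedgeWord w y) z = sgn (wordDeg w * e) • G.wedgeWord w (G.wedge y z) := by
  induction w generalizing y with
  | nil => simp [sgn]
  | cons a w ih =>
    rw [wedgeWord_cons, ih, wedgeWord_cons, G.wedge_assoc, G.wedge_comm_neg a.2.2 hz, map_zsmul,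
      map_zsmul, smul_smul, ← sgn_add, G.wedge_assoc, wordDeg_cons]
    ring_nf

lemma headBracket_wedge {e : ℤ} {y : V} (hy : y ∈ 𝒜 (-e)) (a : Σ i, negG 𝒜 i)
    (w : List (Σ i, negG 𝒜 i)) :
    G.headBracket (e + a.1) w (G.wedge y a.2) = sgn e • G.wedge y (G.pairBracket (a :: w))
      + sgn (a.1 * wordDeg w) • G.wedge (G.headBracket e w y) a.2 := by
  rcases w with _ | ⟨b, _ | ⟨c, w⟩⟩
  · simp
  · simp only [headBracket_singleton, pairBracket_pair, wordDeg_cons, wordDeg_nil,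
      G.bracket_wedge_neg hy a.2.2 b.2.2, map_zsmul, LinearMap.smul_apply, smul_add, smul_smul,
      ← sgn_add]
    congr 2
    simp only [sgn_eq_ite]
    congr 1
    simp only [Int.even_add, Int.even_mul, Int.not_even_one, eq_iff_iff, add_zero]
    tauto
  · simp

lemma headBracket_wedgeWord {e : ℤ} {y : V} (hy : y ∈ 𝒜 (-e)) (t : Σ i, negG 𝒜 i)
    (w : List (Σ i, negG 𝒜 i)) :
    sgn (t.1 * wordDeg w) • G.headBracket (e + wordDeg w) [t] (G.wedgeWord w y)
      = G.wedgeWord w (G.headBracket e [t] y)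
        + sgn e • cutSum w fun u v => G.wedgeWord v (G.wedge y (G.pairBracket (t :: u))) := by
  induction w generalizing e y with
  | nil => simp [cutSum, sgn]
  | cons a w ih =>
    have h := ih (G.wedge_mem_neg hy a.2.2)
    rw [wordDeg_cons, mul_add, sgn_add, mul_smul, wedgeWord_cons, ← add_assoc, h,
      G.headBracket_wedge hy, cutSum, cutSum_eq_nil_left w
        (fun u v => G.wedgeWord v (G.wedge y (G.pairBracket (t :: a :: u))))
        (fun b u v => by simp), G.pairBracket_swap t a]
    simp only [wedgeWord_cons, smul_add, map_add, map_zsmul, zsmul_cutSum, wordDeg_cons,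
      wordDeg_nil, add_zero]
    have e₁ : sgn (t.1 * a.1) • sgn (a.1 * t.1) • G.wedgeWord w
        (G.wedge (G.headBracket e [t] y) a.2)
        = G.wedgeWord w (G.wedge (G.headBracket e [t] y) a.2) := by
      rw [smul_smul, ← sgn_add, mul_comm a.1, ← two_mul, sgn_eq_ite]
      simp
    rw [e₁, smul_comm (sgn e) (sgn (t.1 * a.1))]
    have e₂ (u v : List (Σ i, negG 𝒜 i)) : sgn (t.1 * a.1) • sgn (e + a.1) •
        G.wedgeWord v (G.wedge (G.wedge y a.2) (G.pairBracket (t :: u)))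
        = sgn e • sgn (a.1 * wordDeg u) •
          G.wedgeWord v (G.wedge (G.wedge y (G.pairBracket (t :: u))) a.2) := by
      rw [G.wedge_assoc, G.wedge_assoc, G.wedge_comm_neg a.2.2 (G.pairBracket_mem (t :: u)),
        map_zsmul, map_zsmul]
      simp only [smul_smul, ← sgn_add]
      congr 1
      simp only [sgn_eq_ite]
      congr 1
      simp only [Int.even_add, Int.even_mul, Int.not_even_one, eq_iff_iff, wordDeg_cons]
      tauto
    rw [cutSum_congr e₂]
    abel

lemma cutSum_headBracket_wedgeWord {e : ℤ} {y : V} (hy : y ∈ 𝒜 (-e)) (c : ℕ → ℝ)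
    (w : List (Σ i, negG 𝒜 i)) :
    cutSum w (fun u v => c u.length • G.headBracket (e + wordDeg u) v (G.wedgeWord u y))
      = cutSum w (fun u v => c v.length • G.wedgeWord v (G.headBracket e u y))
        + (2 * sgn e) • cutSum w fun u v =>
          c (v.length + 1) • G.wedgeWord v (G.wedge y (G.pairBracket u)) := by
  induction w generalizing e y c with
  | nil => simp [cutSum]
  | cons a w ih =>
    have h := ih (G.wedge_mem_neg hy a.2.2) fun n => c (n + 1)
    have h₁ := cutSum_eq_nil_right w (fun u v => sgn (a.1 * wordDeg u) • c u.length •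
      G.headBracket (e + wordDeg u) (a :: v) (G.wedgeWord u y)) (fun u b v => by simp)
    have h₂ := cutSum_eq_nil_left w (fun u v => c v.length • G.wedgeWord v
      (G.headBracket e (a :: u) y)) (fun b u v => by simp)
    have h₃ : (cutSum w fun u v =>
        c (v.length + 1) • G.wedgeWord v (G.wedge y (G.pairBracket (a :: u))))
        = c w.length • cutSum w fun u v => G.wedgeWord v (G.wedge y (G.pairBracket (a :: u))) := by
      rw [smul_cutSum]
      refine cutSum_congr' _ _ _ fun u v _ hl => ?_
      by_cases hu : u.length = 1
      · rw [hl, hu, add_comm]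
      · rw [G.pairBracket_eq_zero (w := a :: u) (by simpa using hu)]
        simp
    have e₂ (u v : List (Σ i, negG 𝒜 i)) : (2 * sgn (e + a.1)) • c (v.length + 1 + 1) •
        G.wedgeWord v (G.wedge (G.wedge y a.2) (G.pairBracket u))
        = (2 * sgn e) • sgn (a.1 * wordDeg u) • c (v.length + 1 + 1) •
          G.wedgeWord v (G.wedge (G.wedge y (G.pairBracket u)) a.2) := by
      rw [G.wedge_assoc, G.wedge_assoc, G.wedge_comm_neg a.2.2 (G.pairBracket_mem u),
        map_zsmul, map_zsmul, smul_comm (c _) (sgn _)]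
      simp only [smul_smul, ← sgn_add, mul_assoc]
      congr 2
      simp only [sgn_eq_ite]
      congr 1
      simp only [Int.even_add, Int.even_mul, Int.not_even_one, eq_iff_iff]
      tauto
    simp only [cutSum, wedgeWord_cons, List.length_cons, wordDeg_cons, ← add_assoc] at h ⊢
    rw [h, h₁, h₂, h₃, smul_comm _ (c _), G.headBracket_wedgeWord hy]
    simp only [G.headBracket_wedge hy, map_add, map_zsmul, smul_add, cutSum_add, zsmul_cutSum, e₂]
    have h₄ : (cutSum w fun u v => c (v.length + 1) • sgn e •
        G.wedgeWord v (G.wedge y (G.pairBracket (a :: u)))) = sgn e • c w.length •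
        cutSum w fun u v => G.wedgeWord v (G.wedge y (G.pairBracket (a :: u))) := by
      rw [← h₃, zsmul_cutSum]
      exact cutSum_congr fun u v => smul_comm _ _ _
    rw [h₄, ← zsmul_cutSum (sgn e) w, smul_comm (c w.length) (sgn e), mul_smul 2 (sgn e) (c _ • _),
      two_smul]
    simp only [smul_comm (c _) (sgn _)]
    abel

lemma cutSum_headBracket_pairBracket (w : List (Σ i, negG 𝒜 i)) :
    (cutSum w fun u v => G.headBracket (wordDeg u + 1) v (G.pairBracket u)) = 0 := by
  by_cases hw : w.length = 3
  · obtain ⟨x, y, z, rfl⟩ := List.length_eq_three.1 hw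
    simp only [cutSum, pairBracket_nil, pairBracket_singleton, pairBracket_pair,
      pairBracket_cons_cons_cons, headBracket_singleton, map_zero, smul_zero, zero_add, add_zero,
      wordDeg_cons, wordDeg_nil, map_zsmul]
    rw [G.bracket_antisymm_neg (G.bracket_mem_neg y.2.2 z.2.2) x.2.2,
      G.bracket_antisymm_neg (G.bracket_mem_neg x.2.2 z.2.2) y.2.2, G.jacobi_neg x.2.2 y.2.2]
    simp only [smul_add, smul_neg, smul_smul, neg_add, sgn_eq_ite, Int.even_add, Int.even_mul,
      Int.not_even_one]
    by_cases hx : Even x.1 <;> by_cases hy : Even y.1 <;> by_cases hz : Even z.1 <;>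
      simp [hx, hy, hz] <;> abel
  · refine (cutSum_congr' _ _ _ fun u v _ hl => ?_).trans (cutSum_zero w)
    by_cases hu : u.length = 2
    · exact G.headBracket_eq_zero _ (by omega) _
    · rw [G.pairBracket_eq_zero hu, map_zero]

lemma cutSum_wedge_pairBracket (w : List (Σ i, negG 𝒜 i)) :
    (cutSum w fun u v => sgn (wordDeg u) • G.wedge (G.pairBracket u) (G.pairBracket v)) = 0 := by
  have h : (cutSum w fun u v =>
      sgn (wordDeg u) • G.wedge (G.pairBracket u) (G.pairBracket v))
      = (-1 : ℤ) • cutSum w fun u v =>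
        sgn (wordDeg u) • G.wedge (G.pairBracket u) (G.pairBracket v) := by
    conv_lhs => rw [cutSum_comm]
    rw [zsmul_cutSum]
    refine cutSum_congr fun u v => ?_
    rw [G.wedge_comm_neg (G.pairBracket_mem v) (G.pairBracket_mem u)]
    simp only [smul_smul]
    congr 1
    simp only [sgn_eq_ite, Int.even_add, Int.even_mul, Int.not_even_one]
    by_cases hu : Even (wordDeg u) <;> by_cases hv : Even (wordDeg v) <;> simp [hu, hv]
  rw [neg_one_smul] at h
  exact (smul_eq_zero.1 ((two_smul ℝ _).trans (eq_neg_iff_add_eq_zero.1 h))).resolve_left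
    two_ne_zero

lemma wedgeWord_cutSum (v w : List (Σ i, negG 𝒜 i))
    (Ψ : List (Σ i, negG 𝒜 i) → List (Σ i, negG 𝒜 i) → V) :
    G.wedgeWord v (cutSum w Ψ) = cutSum w fun a b => G.wedgeWord v (Ψ a b) :=
  map_cutSum (G.wedgeWord v).toAddMonoidHom w Ψ

lemma bracketWord_eq_zero {w : List (Σ i, negG 𝒜 i)} (h : w.length < 2) :
    G.bracketWord w = 0 := by
  refine (cutSum_congr' _ _ _ fun u v _ hl => ?_).trans (cutSum_zero w)
  rw [G.pairBracket_eq_zero (by omega), map_zero]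

lemma bracketWord_mem (w : List (Σ i, negG 𝒜 i)) : G.bracketWord w ∈ 𝒜 (-(wordDeg w + 1)) := by
  have key (w : List (Σ i, negG 𝒜 i)) (e : ℤ)
      (Ψ : List (Σ i, negG 𝒜 i) → List (Σ i, negG 𝒜 i) → V)
      (h : ∀ u v, wordDeg u + wordDeg v = wordDeg w → Ψ u v ∈ 𝒜 e) : cutSum w Ψ ∈ 𝒜 e := by
    have := map_cutSum (𝒜 e).mkQ.toAddMonoidHom w Ψ
    rw [cutSum_congr' w (fun u v => (𝒜 e).mkQ.toAddMonoidHom (Ψ u v)) (fun _ _ => 0) fun u v hd _ =>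
      (Submodule.Quotient.mk_eq_zero _).2 (h u v hd.symm), cutSum_zero] at this
    exact (Submodule.Quotient.mk_eq_zero _).1 this
  refine key w _ _ fun u v hd => ?_
  rw [← hd, show wordDeg u + wordDeg v + 1 = wordDeg u + 1 + wordDeg v by ring]
  exact G.wedgeWord_mem (G.pairBracket_mem u) v

lemma wedge_pairBracket_bracketWord (u w : List (Σ i, negG 𝒜 i)) :
    sgn ((wordDeg w + 1) * wordDeg u) • G.wedge (G.pairBracket u) (G.bracketWord w)
      = cutSum w fun a b => sgn (wordDeg b * wordDeg u) • sgn (wordDeg a + 1) •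
          G.wedgeWord b (G.wedge (G.pairBracket a) (G.pairBracket u)) := by
  rw [G.wedge_comm_neg (G.pairBracket_mem u) (G.bracketWord_mem w), smul_smul, bracketWord]
  have hf := map_cutSum (G.wedge.flip (G.pairBracket u)).toAddMonoidHom w
    fun a b => G.wedgeWord b (G.pairBracket a)
  simp only [LinearMap.toAddMonoidHom_coe, LinearMap.flip_apply] at hf
  rw [hf, zsmul_cutSum]
  refine cutSum_congr' _ _ _ fun a b hd _ => ?_
  rw [G.wedgeWord_wedge (G.pairBracket_mem u), smul_smul, smul_smul]
  congr 1
  simp only [hd, sgn_eq_ite, Int.even_add, Int.even_mul, Int.not_even_one]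
  by_cases ha : Even (wordDeg a) <;> by_cases hb : Even (wordDeg b) <;>
    by_cases hu : Even (wordDeg u) <;> simp [ha, hb, hu]

lemma cutSum_wedge_bracketWord (c : ℕ → ℝ) (w : List (Σ i, negG 𝒜 i)) :
    (cutSum w fun u q => c u.length • cutSum q fun u' v =>
      sgn ((wordDeg u + 1) * wordDeg u') •
        G.wedgeWord v (G.wedge (G.pairBracket u') (G.bracketWord u))) = 0 := by
  have expand (u u' v : List (Σ i, negG 𝒜 i)) : c u.length • sgn ((wordDeg u + 1) * wordDeg u') •
      G.wedgeWord v (G.wedge (G.pairBracket u') (G.bracketWord u))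
      = cutSum u fun a b => c u.length • G.wedgeWord v (sgn (wordDeg b * wordDeg u') •
        sgn (wordDeg a + 1) • G.wedgeWord b (G.wedge (G.pairBracket a) (G.pairBracket u'))) := by
    rw [← map_zsmul, wedge_pairBracket_bracketWord, wedgeWord_cutSum, smul_cutSum]
  simp only [smul_cutSum, expand]
  rw [← cutSum_assoc w fun u u' v => cutSum u fun a b => c u.length •
    G.wedgeWord v (sgn (wordDeg b * wordDeg u') • sgn (wordDeg a + 1) •
      G.wedgeWord b (G.wedge (G.pairBracket a) (G.pairBracket u')))]
  have swap (p v : List (Σ i, negG 𝒜 i)) : (cutSum p fun u u' => cutSum u fun a b => c u.length •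
      G.wedgeWord v (sgn (wordDeg b * wordDeg u') • sgn (wordDeg a + 1) •
        G.wedgeWord b (G.wedge (G.pairBracket a) (G.pairBracket u')))) = 0 := by
    have e (u u' : List (Σ i, negG 𝒜 i)) : (cutSum u fun a b => c u.length •
        G.wedgeWord v (sgn (wordDeg b * wordDeg u') • sgn (wordDeg a + 1) •
          G.wedgeWord b (G.wedge (G.pairBracket a) (G.pairBracket u'))))
        = cutSum u fun a b => c (2 + b.length) •
        G.wedgeWord v (sgn (wordDeg b * wordDeg u') • sgn (wordDeg a + 1) •
          G.wedgeWord b (G.wedge (G.pairBracket a) (G.pairBracket u'))) := by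
      refine cutSum_congr' _ _ _ fun a b _ hl => ?_
      by_cases ha : a.length = 2
      · rw [hl, ha]
      · simp [G.pairBracket_eq_zero ha]
    rw [cutSum_congr e, cutSum_assoc p fun a b u' => c (2 + b.length) •
        G.wedgeWord v (sgn (wordDeg b * wordDeg u') • sgn (wordDeg a + 1) •
          G.wedgeWord b (G.wedge (G.pairBracket a) (G.pairBracket u')))]
    have e' (a q : List (Σ i, negG 𝒜 i)) : (cutSum q fun b u' => c (2 + b.length) •
        G.wedgeWord v (sgn (wordDeg b * wordDeg u') • sgn (wordDeg a + 1) •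
          G.wedgeWord b (G.wedge (G.pairBracket a) (G.pairBracket u'))))
        = cutSum q fun u' b => (-c (2 + b.length)) • G.wedgeWord v (G.wedgeWord b
          (sgn (wordDeg a) • G.wedge (G.pairBracket a) (G.pairBracket u'))) := by
      rw [cutSum_comm]
      refine cutSum_congr fun u' b => ?_
      rw [map_zsmul, mul_comm (wordDeg b), smul_comm (c _) (sgn _), smul_smul, ← sgn_add,
        ← two_mul, sgn_add, neg_smul, ← smul_neg, map_zsmul, map_zsmul, map_zsmul]
      simp [sgn_eq_ite]
    rw [cutSum_congr e', ← cutSum_assoc p fun a u' b => (-c (2 + b.length)) •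
      G.wedgeWord v (G.wedgeWord b
          (sgn (wordDeg a) • G.wedge (G.pairBracket a) (G.pairBracket u')))]
    simp only [← smul_cutSum, ← wedgeWord_cutSum, cutSum_wedge_pairBracket, map_zero, smul_zero,
      cutSum_zero]
  simp only [swap, cutSum_zero]

lemma cutSum_headBracket_bracketWord (c : ℕ → ℝ) (w : List (Σ i, negG 𝒜 i)) :
    (cutSum w fun u v => c u.length •
      G.headBracket (wordDeg u + 1) v (G.bracketWord u)) = 0 := by
  have e (u v : List (Σ i, negG 𝒜 i)) :
      c u.length • G.headBracket (wordDeg u + 1) v (G.bracketWord u)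
        = cutSum u fun a b => c (2 + b.length) •
          G.headBracket (wordDeg a + 1 + wordDeg b) v (G.wedgeWord b (G.pairBracket a)) := by
    have hf := map_cutSum (G.headBracket (wordDeg u + 1) v).toAddMonoidHom u
      fun a b => G.wedgeWord b (G.pairBracket a)
    simp only [LinearMap.toAddMonoidHom_coe] at hf
    rw [bracketWord, hf, smul_cutSum]
    refine cutSum_congr' _ _ _ fun a b hd hl => ?_
    rw [hd, add_right_comm]
    by_cases ha : a.length = 2
    · rw [hl, ha]
    · simp [G.pairBracket_eq_zero ha]
  rw [cutSum_congr e, cutSum_assoc w fun a b v => c (2 + b.length) •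
    G.headBracket (wordDeg a + 1 + wordDeg b) v (G.wedgeWord b (G.pairBracket a))]
  simp only [G.cutSum_headBracket_wedgeWord (G.pairBracket_mem _) fun n => c (2 + n), cutSum_add]
  rw [← cutSum_assoc w fun a u v => c (2 + v.length) •
    G.wedgeWord v (G.headBracket (wordDeg a + 1) u (G.pairBracket a))]
  simp only [← smul_cutSum, ← wedgeWord_cutSum, cutSum_headBracket_pairBracket, map_zero,
    smul_zero, cutSum_zero, zero_add]
  have e' (a q : List (Σ i, negG 𝒜 i)) : ((2 * sgn (wordDeg a + 1)) • cutSum q fun u v =>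
      c (2 + (v.length + 1)) • G.wedgeWord v (G.wedge (G.pairBracket a) (G.pairBracket u)))
      = cutSum q fun u v => (-2 * c (2 + (v.length + 1))) • G.wedgeWord v
        (sgn (wordDeg a) • G.wedge (G.pairBracket a) (G.pairBracket u)) := by
    rw [zsmul_cutSum]
    refine cutSum_congr fun u v => ?_
    rw [map_zsmul, sgn_add, show sgn 1 = -1 by simp [sgn], smul_comm _ (sgn (wordDeg a)),
      show 2 * (sgn (wordDeg a) * -1) = sgn (wordDeg a) * (-2) by ring, mul_smul (sgn _)]
    congr 1
    rw [mul_smul (-2 : ℝ), neg_smul, neg_smul, two_smul, two_smul]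
  rw [cutSum_congr e', ← cutSum_assoc w fun a u v => (-2 * c (2 + (v.length + 1))) •
    G.wedgeWord v (sgn (wordDeg a) • G.wedge (G.pairBracket a) (G.pairBracket u))]
  simp only [← smul_cutSum, ← wedgeWord_cutSum, cutSum_wedge_pairBracket, map_zero, smul_zero,
    cutSum_zero]

/-- Inserting the forms `lₘ` into `lₙ` gives zero, for all weights on the arities of the inserted
forms. -/
lemma cutSum_headBracketWord (c : ℕ → ℝ) (w : List (Σ i, negG 𝒜 i)) :
    (cutSum w fun u v => c u.length •
      G.headBracketWord (wordDeg u + 1) v (G.bracketWord u)) = 0 := by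
  simp only [headBracketWord, smul_add, cutSum_add]
  rw [cutSum_wedge_bracketWord, add_zero]
  simp only [smul_cutSum]
  rw [← cutSum_assoc w fun u u' v => c u.length •
    G.wedgeWord v (G.headBracket (wordDeg u + 1) u' (G.bracketWord u))]
  simp only [← map_smul, ← wedgeWord_cutSum]
  simp only [map_smul, cutSum_headBracket_bracketWord, map_zero, cutSum_zero]

end Gerstenhaber

end WordForms

section Forms

variable {V : Type*} [AddCommGroup V] [Module ℝ V]

/-- The form `K` is the restriction of the word function `f` to words of length `k`. -/
def IsWordForm {𝒢 : ℤ → Submodule ℝ V} {k : ℕ} (K : GForm 𝒢 k) (f : List (Σ i, 𝒢 i) → V) : Prop :=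
  ∀ d x, K d x = f (List.ofFn fun i => ⟨d i, x i⟩)

lemma IsWordForm.castForm {𝒢 : ℤ → Submodule ℝ V} {m n : ℕ} {K : GForm 𝒢 m}
    {f : List (Σ i, 𝒢 i) → V} (hK : IsWordForm K f) (h : m = n) :
    IsWordForm (castForm h K) f := by
  subst h
  exact hK

lemma castForm_zero {𝒢 : ℤ → Submodule ℝ V} {m n : ℕ} (h : m = n) :
    castForm h (0 : GForm 𝒢 m) = 0 := by
  subst h
  rfl

lemma IsWordForm.insertPos {𝒢 : ℤ → Submodule ℝ V} [DirectSum.Decomposition 𝒢] {k l : ℕ} (δ : ℤ)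
    {K : GForm 𝒢 k} {L : GForm 𝒢 (l + 1)} {f g : List (Σ i, 𝒢 i) → V}
    (hK : IsWordForm K f) (hL : IsWordForm L g) :
    IsWordForm (insertPos 𝒢 δ K L) fun w => cutSum w fun u v =>
      if u.length = k then g (⟨wordDeg u + δ, prj 𝒢 (wordDeg u + δ) (f u)⟩ :: v) else 0 := by
  intro d x
  refine Eq.trans ?_ (sum_unshuffles_eq_cutSum (Nat.le_add_right k l)
    (fun i => (⟨d i, x i⟩ : Σ i, 𝒢 i))
    fun u v => g (⟨wordDeg u + δ, prj 𝒢 (wordDeg u + δ) (f u)⟩ :: v))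
  refine Finset.sum_congr rfl fun σ _ => ?_
  have hsplit : (List.ofFn fun i => (⟨d (σ i), x (σ i)⟩ : Σ i, 𝒢 i))
      = (List.ofFn fun i => ⟨d (σ (Fin.castAdd l i)), x (σ (Fin.castAdd l i))⟩) ++
        List.ofFn fun i => ⟨d (σ (Fin.natAdd k i)), x (σ (Fin.natAdd k i))⟩ := List.ofFn_add
  rw [hsplit, List.take_left' (by simp), List.drop_left' (by simp), wordDeg_ofFn, hL, hK]
  exact congrArg (fun w => koszulSign d σ • g w) (List.ofFn_succ ..)

variable {𝒜 : ℤ → Submodule ℝ V} (G : Gerstenhaber 𝒜)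

lemma isWordForm_l2G : IsWordForm (l2G G (negG 𝒜)) G.pairBracket := fun _ _ => rfl

lemma wedgeAll_eq_wedgeWord {k : ℕ} (z : Fin (k + 1) → Σ i, negG 𝒜 i) :
    wedgeAll G (fun i => ((z i).2 : V)) = G.wedgeWord (List.ofFn fun i => z i.succ) (z 0).2 := by
  induction k with
  | zero => rfl
  | succ k ih =>
    rw [wedgeAll, ih fun i => z i.succ, G.wedge_wedgeWord, List.ofFn_succ]
    rfl

lemma isWordForm_mathcalN (k : ℕ) : IsWordForm (mathcalN G (negG 𝒜) (k + 1))
    fun w => G.wedgeWord w.tail (w.head?.elim 0 fun a => (a.2 : V)) := by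
  intro d x
  rw [List.ofFn_succ]
  exact wedgeAll_eq_wedgeWord G fun i => ⟨d i, x i⟩

lemma prj_coe_of_mem {𝒢 : ℤ → Submodule ℝ V} [DirectSum.Decomposition 𝒢] {i : ℤ} {v : V}
    (h : v ∈ 𝒢 i) : (prj 𝒢 i v : V) = v :=
  DirectSum.decompose_of_mem_same 𝒢 h

variable [DirectSum.Decomposition (negG 𝒜)]

lemma isWordForm_lFormsG (k : ℕ) : IsWordForm (lFormsG G (negG 𝒜) k) G.bracketWord := by
  match k with
  | 0 | 1 => exact fun d x => (G.bracketWord_eq_zero (by simp)).symm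
  | 2 =>
    intro d x
    simp [lFormsG, l2G, Gerstenhaber.bracketWord, cutSum, sgn, List.ofFn_succ]
  | k + 3 =>
    refine IsWordForm.castForm (m := 2 + (k + 1)) ?_ (by omega)
    intro d x
    refine ((isWordForm_l2G G).insertPos 1 (isWordForm_mathcalN G (k + 1)) d x).trans ?_
    refine cutSum_congr fun u v => ?_
    split_ifs with hu
    · simp only [List.tail_cons, List.head?_cons, Option.elim_some]
      rw [prj_coe_of_mem (𝒢 := negG 𝒜) (G.pairBracket_mem u)]
    · rw [G.pairBracket_eq_zero hu, map_zero]

lemma insertionOp_lFormsG (a b : ℕ → ℝ) (m n : ℕ) :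
    insertionOp (negG 𝒜) 1 (a m • lFormsG G (negG 𝒜) m) (b n • lFormsG G (negG 𝒜) n) = 0 := by
  match n with
  | 0 => rfl
  | n + 1 =>
    have smul (c : ℝ) (k : ℕ) :
        IsWordForm (c • lFormsG G (negG 𝒜) k) fun w => c • G.bracketWord w := fun d x =>
      congrArg (c • ·) (isWordForm_lFormsG G k d x)
    funext d x
    refine ((smul (a m) m).insertPos 1 (smul (b (n + 1)) (n + 1)) d x).trans ?_
    have key := G.cutSum_headBracketWord (fun j => if j = m then b (n + 1) * a m else 0)
      (List.ofFn fun i => (⟨d i, x i⟩ : Σ i, negG 𝒜 i))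
    refine Eq.trans (cutSum_congr fun u v => ?_) key
    split_ifs with hu
    · have hp := prj_coe_of_mem (𝒢 := negG 𝒜)
        ((negG 𝒜 (wordDeg u + 1)).smul_mem (a m) (G.bracketWord_mem u))
      rw [G.bracketWord_cons, hp, mul_smul]
      congr 1
      simp only [Gerstenhaber.headBracketWord, map_smul, smul_add, smul_cutSum]
      congr 1
      exact cutSum_congr fun u' v' => smul_comm _ _ _
    · rw [zero_smul]

lemma rnBracketM_lFormsG (a b : ℕ → ℝ) :
    rnBracketM (negG 𝒜) 1 1 (fun k => a k • lFormsG G (negG 𝒜) k)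
      (fun k => b k • lFormsG G (negG 𝒜) k) = 0 := by
  funext n
  simp only [rnBracketM, insertionOp_lFormsG, castForm_zero, Finset.sum_const_zero, smul_zero,
    sub_zero, Pi.zero_apply]

lemma singleF_lFormsG (m : ℕ) : singleF (negG 𝒜) m (lFormsG G (negG 𝒜) m)
    = fun k => (if k = m then (1 : ℝ) else 0) • lFormsG G (negG 𝒜) k := by
  funext k
  unfold singleF
  split_ifs with h
  · subst h
    exact (one_smul ℝ _).symm
  · exact (zero_smul ℝ _).symm

end Forms

/-- The family `(l_n)_{n≥1}` is a pencil of `L_∞`-algebras on `E`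
(all pairwise Richardson–Nijenhuis brackets vanish) and hence any formal sum
`μ = Σ_{i≥1} a_i l_i` is an `L_∞`-structure on `E`. -/
theorem lForms_pencil
    {V : Type*} [AddCommGroup V] [Module ℝ V] {𝒜 : ℤ → Submodule ℝ V}
    (G : Gerstenhaber 𝒜) [DirectSum.Decomposition (negG 𝒜)] :
    (∀ m n : ℕ, 1 ≤ m → 1 ≤ n →
      rnBracketM (negG 𝒜) 1 1 (singleF (negG 𝒜) m (lFormsG G (negG 𝒜) m))
        (singleF (negG 𝒜) n (lFormsG G (negG 𝒜) n)) = 0) ∧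
    (∀ a : ℕ → ℝ,
      rnBracketM (negG 𝒜) 1 1 (fun k => a k • lFormsG G (negG 𝒜) k)
        (fun k => a k • lFormsG G (negG 𝒜) k) = 0) := by
  refine ⟨fun m n _ _ => ?_, fun a => rnBracketM_lFormsG G a a⟩
  rw [singleF_lFormsG, singleF_lFormsG]
  exact rnBracketM_lFormsG G _ _
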